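/- arXiv:1701.04309 — 3 statements merged into one kernel-verified Lean document; each statement's English description precedes it below -/
import Mathlib

section
/- For every p ∈ 𝕄²ˣ²_sym with |p_D| ≤ (tr p)/(2α), the support function of K at p equals κ(tr p)/(2α); that is, sup{σ : p | σ ∈ K} = κ(tr p)/(2α). -/
open Matrix Set
open scoped Classical

attribute [local instance] Matrix.frobeniusNormedAddCommGroup Matrix.frobeniusNormedSpace

noncomputable section

/-- The space of real 2×2 matrices (symmetric ones are singled out by `Matrix.IsSymm`). -/
abbrev M2 : Type := Matrix (Fin 2) (Fin 2) ℝ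

/-- Frobenius inner product `A : B = tr (Aᵀ B)`. -/
def inn (A B : M2) : ℝ := (Aᵀ * B).trace

/-- Frobenius norm `|A| = √(A : A)`. -/
def fnorm (A : M2) : ℝ := Real.sqrt (inn A A)

/-- Deviatoric part `A_D = A − (tr A / 2) Id`. -/
def dev (A : M2) : M2 := A - (A.trace / 2) • (1 : M2)

/-- The set of symmetric matrices `𝕄²ˣ²_sym`. -/
def Msym : Set M2 := {A | A.IsSymm}

/-- The Drucker–Prager elasticity set `K = {σ ∈ 𝕄²ˣ²_sym : |σ_D| + α tr σ ≤ κ}`. -/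
def Kset (α κ : ℝ) : Set M2 :=
  {σ | σ.IsSymm ∧ fnorm (dev σ) + α * σ.trace ≤ κ}

/-- The isotropic elasticity tensor `ℂ e = λ (tr e) Id + 2 μ e`. -/
def Cc (lam mu : ℝ) (e : M2) : M2 := (lam * e.trace) • (1 : M2) + (2 * mu) • e

/-- The inverse elasticity tensor `ℂ⁻¹ σ = (tr σ / (4 K₀)) Id + (1/(2μ)) σ_D`, `K₀ = λ + μ`. -/
def Cinv (lam mu : ℝ) (σ : M2) : M2 :=
  (σ.trace / (4 * (lam + mu))) • (1 : M2) + (1 / (2 * mu)) • dev σ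

/-- The constant `β = (1/μ + 1/(2 α² K₀))⁻¹`. -/
def betaC (α lam mu : ℝ) : ℝ := (1 / mu + 1 / (2 * α ^ 2 * (lam + mu)))⁻¹

/-- The function `g`. -/
def gfun (α κ lam mu : ℝ) (ξ : M2) : ℝ :=
  if 2 * mu * fnorm (dev ξ) + 2 * α * (lam + mu) * ξ.trace ≤ κ then
    ((lam + mu) / 2) * ξ.trace ^ 2 + mu * fnorm (dev ξ) ^ 2
  else
    κ * ξ.trace / (2 * α) - κ ^ 2 / (8 * α ^ 2 * (lam + mu)) +
      betaC α lam mu *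
        max (fnorm (dev ξ) - ξ.trace / (2 * α) + κ / (4 * α ^ 2 * (lam + mu))) 0 ^ 2

/-- The (matrix representing the) differential of `g`. -/
def Dg (α κ lam mu : ℝ) (ξ : M2) : M2 :=
  if 2 * mu * fnorm (dev ξ) + 2 * α * (lam + mu) * ξ.trace ≤ κ then
    ((lam + mu) * ξ.trace) • (1 : M2) + (2 * mu) • dev ξ
  else
    (κ / (2 * α)) • (1 : M2) +
      (2 * betaC α lam mu *
          max (fnorm (dev ξ) - ξ.trace / (2 * α) + κ / (4 * α ^ 2 * (lam + mu))) 0) •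
        ((fnorm (dev ξ))⁻¹ • dev ξ - (1 / (2 * α)) • (1 : M2))

/-- The open cone `𝒜₁ = {ξ ∈ 𝕄²ˣ²_sym : μ |ξ_D| + α K₀ tr ξ < 0}`. -/
def A1 (α lam mu : ℝ) : Set M2 :=
  {ξ | ξ.IsSymm ∧ mu * fnorm (dev ξ) + α * (lam + mu) * ξ.trace < 0}

/-- The open cone `𝒜₂ = {ξ ∈ 𝕄²ˣ²_sym : |ξ_D| < tr ξ / (2α)}`. -/
def A2 (α : ℝ) : Set M2 :=
  {ξ | ξ.IsSymm ∧ fnorm (dev ξ) < ξ.trace / (2 * α)}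

/-- The cone `𝒜₃ = 𝕄²ˣ²_sym ∖ (cl 𝒜₁ ∪ cl 𝒜₂)`. -/
def A3 (α lam mu : ℝ) : Set M2 :=
  Msym \ (closure (A1 α lam mu) ∪ closure (A2 α))

/-- The function `G(ξ) = Dg(ξ + (κ/(4αK₀)) Id)`, given by its explicit piecewise expression. -/
def Gfun (α κ lam mu : ℝ) (ξ : M2) : M2 :=
  if ξ ∈ A1 α lam mu then
    (κ / (2 * α)) • (1 : M2) + ((lam + mu) * ξ.trace) • (1 : M2) + (2 * mu) • dev ξ
  else if ξ ∈ A2 α ∨ ξ = 0 then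
    (κ / (2 * α)) • (1 : M2)
  else
    (κ / (2 * α)) • (1 : M2) +
      (2 * betaC α lam mu * (fnorm (dev ξ) - ξ.trace / (2 * α))) •
        ((fnorm (dev ξ))⁻¹ • dev ξ - (1 / (2 * α)) • (1 : M2))

/-- The map `𝒢(ξ, η)`. -/
def calG (α lam mu : ℝ) (ξ η : M2) : M2 :=
  if ξ ∈ A1 α lam mu then
    ((lam + mu) * η.trace) • (1 : M2) + (2 * mu) • dev η
  else if ξ ∈ A2 α ∨ ξ = 0 then
    0
  else
    (2 * betaC α lam mu * (inn (dev ξ) (dev η) / fnorm (dev ξ) - η.trace / (2 * α))) •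
      ((fnorm (dev ξ))⁻¹ • dev ξ - (1 / (2 * α)) • (1 : M2)) +
    (2 * betaC α lam mu * (fnorm (dev ξ) - ξ.trace / (2 * α)) * (fnorm (dev ξ))⁻¹) •
      (dev η - (inn (dev ξ) (dev η) / fnorm (dev ξ) ^ 2) • dev ξ)

/-- The relative boundary `∂𝒜₁` of `𝒜₁` inside `𝕄²ˣ²_sym`. -/
def bdryA1 (α lam mu : ℝ) : Set M2 := closure (A1 α lam mu) \ A1 α lam mu

/-- The relative boundary `∂𝒜₂` of `𝒜₂` inside `𝕄²ˣ²_sym`. -/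
def bdryA2 (α : ℝ) : Set M2 := closure (A2 α) \ A2 α

/-- The outward normal `ν(σ) = μ σ_D/|σ_D| + α K₀ Id` for `σ ∈ ∂𝒜₁ ∖ {0}`. -/
def nu1 (α lam mu : ℝ) (σ : M2) : M2 :=
  (mu * (fnorm (dev σ))⁻¹) • dev σ + (α * (lam + mu)) • (1 : M2)

/-- The outward normal `ν(σ) = σ_D/|σ_D| − (1/(2α)) Id` for `σ ∈ ∂𝒜₂ ∖ {0}`. -/
def nu2 (α : ℝ) (σ : M2) : M2 :=
  (fnorm (dev σ))⁻¹ • dev σ - (1 / (2 * α)) • (1 : M2)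

lemma inn_eq_sum (A B : M2) :
    inn A B = A 0 0 * B 0 0 + A 0 1 * B 0 1 + A 1 0 * B 1 0 + A 1 1 * B 1 1 := by
  simp [inn, Matrix.trace, Matrix.mul_apply, Fin.sum_univ_two]
  ring

/-- Cauchy–Schwarz inequality for the Frobenius inner product. -/
lemma inn_le_fnorm_mul_fnorm (A B : M2) : inn A B ≤ fnorm A * fnorm B := by
  have h (C : M2) : 0 ≤ inn C C := by
    rw [inn_eq_sum]
    nlinarith [sq_nonneg (C 0 0), sq_nonneg (C 0 1), sq_nonneg (C 1 0), sq_nonneg (C 1 1)]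
  rw [fnorm, fnorm, ← Real.sqrt_mul (h A)]
  apply Real.le_sqrt_of_sq_le
  simp only [inn_eq_sum]
  nlinarith [sq_nonneg (A 0 0 * B 0 1 - A 0 1 * B 0 0), sq_nonneg (A 0 0 * B 1 0 - A 1 0 * B 0 0),
    sq_nonneg (A 0 0 * B 1 1 - A 1 1 * B 0 0), sq_nonneg (A 0 1 * B 1 0 - A 1 0 * B 0 1),
    sq_nonneg (A 0 1 * B 1 1 - A 1 1 * B 0 1), sq_nonneg (A 1 0 * B 1 1 - A 1 1 * B 1 0)]

/-- Orthogonal decomposition into deviatoric and spherical parts. -/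
lemma inn_eq_inn_dev_add (A B : M2) :
    inn A B = inn (dev A) (dev B) + A.trace * B.trace / 2 := by
  simp [inn_eq_sum, dev, Matrix.trace, Fin.sum_univ_two]
  ring

lemma trace_smul_one (c : ℝ) : (c • (1 : M2)).trace = 2 * c := by
  simp [Matrix.trace]

lemma dev_smul_one (c : ℝ) : dev (c • (1 : M2)) = 0 := by
  rw [dev, trace_smul_one, mul_div_cancel_left₀ c two_ne_zero, sub_self]

lemma fnorm_zero : fnorm 0 = 0 := by
  simp [fnorm, inn]

lemma smul_one_mem_Kset {α : ℝ} (κ : ℝ) (hα : 0 < α) :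
    (κ / (2 * α)) • (1 : M2) ∈ Kset α κ := by
  refine ⟨Matrix.isSymm_one.smul _, le_of_eq ?_⟩
  rw [dev_smul_one, fnorm_zero, trace_smul_one]
  field_simp
  ring

/-- For `p ∈ 𝕄²ˣ²_sym` with `|p_D| ≤ tr p / (2α)`, the support function of the
Drucker–Prager set `K` at `p` equals `κ (tr p) / (2α)`. -/
theorem stmt_0 (α κ : ℝ) (hα : 0 < α) (hκ : 0 < κ) (p : M2) (hp : p.IsSymm)
    (hpd : fnorm (dev p) ≤ p.trace / (2 * α)) :
    IsLUB {x : ℝ | ∃ σ ∈ Kset α κ, x = inn σ p} (κ * p.trace / (2 * α)) := by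
  apply IsGreatest.isLUB
  refine ⟨⟨_, smul_one_mem_Kset κ hα, ?_⟩, ?_⟩
  · simp only [inn, Matrix.transpose_smul, Matrix.transpose_one, Matrix.smul_mul, Matrix.one_mul,
      Matrix.trace_smul, smul_eq_mul]
    ring
  · rintro _ ⟨σ, ⟨-, hσ⟩, rfl⟩
    have hσ' : fnorm (dev σ) ≤ κ - α * σ.trace := by linarith
    calc
      inn σ p = inn (dev σ) (dev p) + σ.trace * p.trace / 2 := inn_eq_inn_dev_add σ p
      _ ≤ fnorm (dev σ) * fnorm (dev p) + σ.trace * p.trace / 2 := by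
        gcongr
        exact inn_le_fnorm_mul_fnorm _ _
      _ ≤ (κ - α * σ.trace) * (p.trace / (2 * α)) + σ.trace * p.trace / 2 := by
        gcongr
        · exact Real.sqrt_nonneg _
        · exact (Real.sqrt_nonneg _).trans hσ'
      _ = κ * p.trace / (2 * α) := by
        field_simp
        ring
end
end

section
/- The function G is Lipschitz continuous on 𝕄²ˣ²_sym. -/
open Matrix Set
open scoped Classical

attribute [local instance] Matrix.frobeniusNormedAddCommGroup Matrix.frobeniusNormedSpace

noncomputable section

/-- `fnorm` is the Frobenius norm. -/
lemma fnorm_eq_norm (A : M2) : fnorm A = ‖A‖ := by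
  rw [fnorm, inn, Matrix.frobenius_norm_def, ← Real.sqrt_eq_rpow]
  congr 1
  simp [Matrix.trace, Matrix.mul_apply, Fin.sum_univ_two]
  ring

lemma exists_abs_trace_le : ∃ C : ℝ, 0 ≤ C ∧ ∀ A : M2, |A.trace| ≤ C * ‖A‖ :=
  ⟨_, norm_nonneg _, fun A =>
    (LinearMap.toContinuousLinearMap (Matrix.traceLinearMap (Fin 2) ℝ ℝ)).le_opNorm A⟩

lemma dev_sub (A B : M2) : dev (A - B) = dev A - dev B := by
  simp only [dev, Matrix.trace_sub]
  module

lemma exists_norm_dev_le : ∃ C : ℝ, 0 ≤ C ∧ ∀ A : M2, ‖dev A‖ ≤ C * ‖A‖ := by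
  obtain ⟨τ, hτ, h⟩ := exists_abs_trace_le
  refine ⟨1 + τ / 2 * ‖(1 : M2)‖, by positivity, fun A => ?_⟩
  calc ‖dev A‖ ≤ ‖A‖ + |A.trace| / 2 * ‖(1 : M2)‖ := by
        refine (norm_sub_le _ _).trans_eq ?_
        rw [norm_smul, Real.norm_eq_abs, abs_div, abs_two]
    _ ≤ ‖A‖ + τ * ‖A‖ / 2 * ‖(1 : M2)‖ := by gcongr; exact h A
    _ = _ := by ring

/-- Rescaling vectors to prescribed lengths `a ≤ c ‖x‖` is Lipschitz in the vector and the length. -/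
lemma norm_rescale_sub_le {E : Type*} [NormedAddCommGroup E] [NormedSpace ℝ E] {c a b : ℝ}
    {x y : E} (hc : 0 ≤ c) (ha : 0 ≤ a) (hax : a ≤ c * ‖x‖) (hb : 0 ≤ b) (hby : b ≤ c * ‖y‖) :
    ‖(a * ‖x‖⁻¹) • x - (b * ‖y‖⁻¹) • y‖ ≤ 2 * c * ‖x - y‖ + |a - b| := by
  have cancel : ∀ {d : ℝ} {z : E}, 0 ≤ d → d ≤ c * ‖z‖ → d * ‖z‖⁻¹ * ‖z‖ = d := by
    intro d z hd hdz
    rcases eq_or_ne ‖z‖ 0 with hz | hz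
    · rw [hz, mul_zero] at hdz
      rw [hz, mul_zero]
      linarith
    · field_simp
  set q := a * ‖x‖⁻¹ with hq
  have hq0 : 0 ≤ q := by positivity
  have hqc : q ≤ c := by
    rw [hq, ← div_eq_mul_inv]
    exact div_le_of_le_mul₀ (norm_nonneg _) hc hax
  have hxy : |‖y‖ - ‖x‖| ≤ ‖x - y‖ := by
    rw [norm_sub_rev]; exact abs_norm_sub_norm_le y x
  have hdiff : |q - b * ‖y‖⁻¹| * ‖y‖ ≤ c * ‖x - y‖ + |a - b| := by
    rw [← abs_of_nonneg (norm_nonneg y), ← abs_mul, abs_of_nonneg (norm_nonneg y)]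
    have : (q - b * ‖y‖⁻¹) * ‖y‖ = q * (‖y‖ - ‖x‖) + (a - b) := by
      rw [sub_mul, cancel hb hby, mul_sub, cancel ha hax]; ring
    rw [this]
    refine (abs_add_le _ _).trans ?_
    rw [abs_mul, abs_of_nonneg hq0]
    gcongr
  calc ‖q • x - (b * ‖y‖⁻¹) • y‖ = ‖q • (x - y) + (q - b * ‖y‖⁻¹) • y‖ := by
        congr 1; module
    _ ≤ q * ‖x - y‖ + |q - b * ‖y‖⁻¹| * ‖y‖ := by
        refine (norm_add_le _ _).trans_eq ?_
        rw [norm_smul, norm_smul, Real.norm_eq_abs, Real.norm_eq_abs, abs_of_nonneg hq0]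
    _ ≤ c * ‖x - y‖ + (c * ‖x - y‖ + |a - b|) := by gcongr
    _ = _ := by ring

/-- The excess `(|ξ_D| - tr ξ / (2α))₊`. -/
def excess (α : ℝ) (ξ : M2) : ℝ := max (‖dev ξ‖ - ξ.trace / (2 * α)) 0

/-- The spherical coefficient of `G`, up to the constant `κ / (2α)`. -/
def sphCoeff (α lam mu : ℝ) (ξ : M2) : ℝ :=
  min (-(betaC α lam mu / α) * excess α ξ) ((lam + mu) * ξ.trace)

/-- The length of the deviatoric part of `G`. -/
def devLength (α lam mu : ℝ) (ξ : M2) : ℝ :=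
  min (2 * mu * ‖dev ξ‖) (2 * betaC α lam mu * excess α ξ)

lemma betaC_pos {α lam mu : ℝ} (hα : 0 < α) (hmu : 0 < mu) (hlm : 0 < lam + mu) :
    0 < betaC α lam mu := by
  unfold betaC; positivity

lemma betaC_mul {α lam mu : ℝ} (hα : 0 < α) (hmu : 0 < mu) (hlm : 0 < lam + mu) :
    betaC α lam mu * (2 * α ^ 2 * (lam + mu) + mu) = 2 * α ^ 2 * (lam + mu) * mu := by
  unfold betaC
  have : 2 * α ^ 2 * (lam + mu) + mu ≠ 0 := by positivity
  field_simp

/-- The identities comparing the branches of `G` across `∂𝒜₁`. -/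
lemma branch_identities {α lam mu : ℝ} (hα : 0 < α) (hmu : 0 < mu) (hlm : 0 < lam + mu)
    (s t : ℝ) :
    (lam + mu) * t - -(betaC α lam mu / α) * (s - t / (2 * α)) =
        betaC α lam mu / (α * mu) * (mu * s + α * (lam + mu) * t) ∧
      2 * mu * s - 2 * betaC α lam mu * (s - t / (2 * α)) =
        betaC α lam mu / (α ^ 2 * (lam + mu)) * (mu * s + α * (lam + mu) * t) := by
  have h := betaC_mul hα hmu hlm
  constructor
  · field_simp
    linear_combination (-t) * h
  · field_simp
    linear_combination (-s) * h

/-- A formula for `G` without case distinctions. -/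
lemma Gfun_eq {α lam mu : ℝ} (κ : ℝ) (hα : 0 < α) (hmu : 0 < mu) (hlm : 0 < lam + mu)
    {ξ : M2} (hξ : ξ.IsSymm) :
    Gfun α κ lam mu ξ = (κ / (2 * α)) • (1 : M2) + sphCoeff α lam mu ξ • (1 : M2) +
      (devLength α lam mu ξ * ‖dev ξ‖⁻¹) • dev ξ := by
  have hβ := betaC_pos hα hmu hlm
  obtain ⟨e₁, e₂⟩ := branch_identities hα hmu hlm ‖dev ξ‖ ξ.trace
  have c₁ : 0 < betaC α lam mu / (α * mu) := by positivity
  have c₂ : 0 < betaC α lam mu / (α ^ 2 * (lam + mu)) := by positivity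
  have hs := norm_nonneg (dev ξ)
  unfold Gfun sphCoeff devLength excess
  split_ifs with h₁ h₂
  · have hr : mu * ‖dev ξ‖ + α * (lam + mu) * ξ.trace < 0 := by
      have := h₁.2; rwa [fnorm_eq_norm] at this
    have ht : ξ.trace < 0 := by
      have : 0 ≤ mu * ‖dev ξ‖ := by positivity
      by_contra! h
      have : 0 ≤ α * (lam + mu) * ξ.trace := by positivity
      linarith
    have ht' : ξ.trace / (2 * α) < 0 := div_neg_of_neg_of_pos ht (by positivity)
    rw [max_eq_left (by linarith), min_eq_right (by nlinarith), min_eq_left (by nlinarith)]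
    congr 1
    rcases eq_or_ne (dev ξ) 0 with h0 | h0
    · simp [h0]
    · rw [mul_assoc, mul_inv_cancel₀ (norm_ne_zero_iff.2 h0), mul_one]
  · have hp : ‖dev ξ‖ - ξ.trace / (2 * α) ≤ 0 ∧ 0 ≤ ξ.trace := by
      rcases h₂ with h₂ | rfl
      · have h := h₂.2
        rw [fnorm_eq_norm] at h
        refine ⟨by linarith, ?_⟩
        by_contra! ht
        have := div_neg_of_neg_of_pos ht (show 0 < 2 * α by positivity)
        linarith
      · simp [dev]
    have ht := hp.2
    rw [max_eq_right hp.1, mul_zero, mul_zero, min_eq_left (by positivity),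
      min_eq_right (by positivity)]
    simp
  · have hr : 0 ≤ mu * ‖dev ξ‖ + α * (lam + mu) * ξ.trace := by
      by_contra! h
      exact h₁ ⟨hξ, by rwa [fnorm_eq_norm]⟩
    have hp : 0 ≤ ‖dev ξ‖ - ξ.trace / (2 * α) := by
      by_contra! h
      exact h₂ (Or.inl ⟨hξ, by rw [fnorm_eq_norm]; linarith⟩)
    rw [max_eq_left hp, min_eq_left (by nlinarith), min_eq_right (by nlinarith), fnorm_eq_norm]
    module

lemma abs_excess_sub_le {α : ℝ} (hα : 0 < α) (ξ ζ : M2) :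
    |excess α ξ - excess α ζ| ≤ ‖dev (ξ - ζ)‖ + |(ξ - ζ).trace| / (2 * α) := by
  unfold excess
  refine (abs_max_sub_max_le_abs _ _ _).trans ?_
  rw [show ‖dev ξ‖ - ξ.trace / (2 * α) - (‖dev ζ‖ - ζ.trace / (2 * α)) =
    (‖dev ξ‖ - ‖dev ζ‖) - (ξ - ζ).trace / (2 * α) by rw [Matrix.trace_sub]; ring]
  refine (abs_sub _ _).trans ?_
  rw [abs_div, abs_of_pos (show 0 < 2 * α by positivity), dev_sub]
  gcongr
  exact abs_norm_sub_norm_le _ _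

lemma abs_min_sub_min_le_add (a b c d : ℝ) : |min a b - min c d| ≤ |a - c| + |b - d| :=
  (abs_min_sub_min_le_max a b c d).trans (max_le_add_of_nonneg (abs_nonneg _) (abs_nonneg _))

lemma abs_sphCoeff_sub_le {α lam mu : ℝ} (hα : 0 < α) (hmu : 0 < mu) (hlm : 0 < lam + mu)
    (ξ ζ : M2) :
    |sphCoeff α lam mu ξ - sphCoeff α lam mu ζ| ≤
      betaC α lam mu / α * |excess α ξ - excess α ζ| + (lam + mu) * |(ξ - ζ).trace| := by
  have hβ := betaC_pos hα hmu hlm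
  refine (abs_min_sub_min_le_add _ _ _ _).trans_eq ?_
  rw [← mul_sub, ← mul_sub, abs_mul, abs_mul, abs_neg, abs_of_pos hlm,
    abs_of_pos (show 0 < betaC α lam mu / α by positivity), Matrix.trace_sub]

lemma abs_devLength_sub_le {α lam mu : ℝ} (hα : 0 < α) (hmu : 0 < mu) (hlm : 0 < lam + mu)
    (ξ ζ : M2) :
    |devLength α lam mu ξ - devLength α lam mu ζ| ≤
      2 * mu * ‖dev (ξ - ζ)‖ + 2 * betaC α lam mu * |excess α ξ - excess α ζ| := by
  have hβ := betaC_pos hα hmu hlm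
  refine (abs_min_sub_min_le_add _ _ _ _).trans ?_
  rw [← mul_sub, ← mul_sub, abs_mul (2 * mu), abs_mul (2 * betaC α lam mu),
    abs_of_pos (show 0 < 2 * mu by positivity),
    abs_of_pos (show 0 < 2 * betaC α lam mu by positivity), dev_sub]
  gcongr
  exact abs_norm_sub_norm_le _ _

/-- `G` is Lipschitz continuous on `𝕄²ˣ²_sym`. -/
theorem stmt_12 (α κ lam mu : ℝ) (hα : 0 < α) (hκ : 0 < κ) (hmu : 0 < mu)
    (hlm : 0 < lam + mu) :
    ∃ C : ℝ, ∀ ξ ζ : M2, ξ.IsSymm → ζ.IsSymm →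
      fnorm (Gfun α κ lam mu ξ - Gfun α κ lam mu ζ) ≤ C * fnorm (ξ - ζ) := by
  obtain ⟨τ, hτ, htr⟩ := exists_abs_trace_le
  obtain ⟨δ, hδ, hdev⟩ := exists_norm_dev_le
  have hβ := betaC_pos hα hmu hlm
  set β := betaC α lam mu with hβdef
  set ε := δ + τ / (2 * α) with hε
  refine ⟨(β / α * ε + (lam + mu) * τ) * ‖(1 : M2)‖ +
    (2 * (2 * mu) * δ + (2 * mu * δ + 2 * β * ε)), fun ξ ζ hξ hζ => ?_⟩
  have hlen : ∀ χ : M2, 0 ≤ devLength α lam mu χ ∧ devLength α lam mu χ ≤ 2 * mu * ‖dev χ‖ := by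
    intro χ
    have : 0 ≤ excess α χ := le_max_right _ _
    exact ⟨le_min (by positivity) (by positivity), min_le_left _ _⟩
  have hexc : |excess α ξ - excess α ζ| ≤ ε * ‖ξ - ζ‖ := by
    calc _ ≤ ‖dev (ξ - ζ)‖ + |(ξ - ζ).trace| / (2 * α) := abs_excess_sub_le hα ξ ζ
      _ ≤ δ * ‖ξ - ζ‖ + τ * ‖ξ - ζ‖ / (2 * α) := by
        gcongr
        · exact hdev _
        · exact htr _
      _ = _ := by rw [hε]; ring
  have hsph : |sphCoeff α lam mu ξ - sphCoeff α lam mu ζ| ≤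
      (β / α * ε + (lam + mu) * τ) * ‖ξ - ζ‖ := by
    calc _ ≤ _ := abs_sphCoeff_sub_le hα hmu hlm ξ ζ
      _ ≤ β / α * (ε * ‖ξ - ζ‖) + (lam + mu) * (τ * ‖ξ - ζ‖) := by
        gcongr
        exact htr _
      _ = _ := by ring
  have hlength : |devLength α lam mu ξ - devLength α lam mu ζ| ≤
      (2 * mu * δ + 2 * β * ε) * ‖ξ - ζ‖ := by
    calc _ ≤ _ := abs_devLength_sub_le hα hmu hlm ξ ζ
      _ ≤ 2 * mu * (δ * ‖ξ - ζ‖) + 2 * β * (ε * ‖ξ - ζ‖) := by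
        gcongr
        exact hdev _
      _ = _ := by ring
  have hdir := norm_rescale_sub_le (x := dev ξ) (y := dev ζ) (by positivity) (hlen ξ).1 (hlen ξ).2
    (hlen ζ).1 (hlen ζ).2
  rw [← dev_sub] at hdir
  rw [fnorm_eq_norm, fnorm_eq_norm, Gfun_eq κ hα hmu hlm hξ, Gfun_eq κ hα hmu hlm hζ,
    add_sub_add_comm, add_sub_add_left_eq_sub, ← sub_smul]
  calc _ ≤ |sphCoeff α lam mu ξ - sphCoeff α lam mu ζ| * ‖(1 : M2)‖ +
        (2 * (2 * mu) * ‖dev (ξ - ζ)‖ + |devLength α lam mu ξ - devLength α lam mu ζ|) := by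
        refine (norm_add_le _ _).trans (add_le_add ?_ hdir)
        rw [norm_smul, Real.norm_eq_abs]
    _ ≤ (β / α * ε + (lam + mu) * τ) * ‖ξ - ζ‖ * ‖(1 : M2)‖ +
        (2 * (2 * mu) * (δ * ‖ξ - ζ‖) + (2 * mu * δ + 2 * β * ε) * ‖ξ - ζ‖) := by
        gcongr
        exact hdev _
    _ = _ := by ring
end
end

section
/- For every ξ ∈ 𝕄²ˣ²_sym, the bilinear form (η₁,η₂) ↦ 𝒢(ξ,η₁) : η₂ on 𝕄²ˣ²_sym is symmetric and positive semidefinite; consequently, for all η₁, η₂ ∈ 𝕄²ˣ²_sym one has 𝒢(ξ,η₁) : η₂ ≤ √(𝒢(ξ,η₁):η₁) · √(𝒢(ξ,η₂):η₂). -/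
open Matrix Set
open scoped Classical

attribute [local instance] Matrix.frobeniusNormedAddCommGroup Matrix.frobeniusNormedSpace

noncomputable section

lemma inn_comm (A B : M2) : inn A B = inn B A := by
  simp only [inn_eq_sum]
  ring

lemma inn_add_left (A B C : M2) : inn (A + B) C = inn A C + inn B C := by
  simp [inn, Matrix.add_mul]

lemma inn_sub_left (A B C : M2) : inn (A - B) C = inn A C - inn B C := by
  simp [inn, Matrix.sub_mul]

lemma inn_smul_left (c : ℝ) (A B : M2) : inn (c • A) B = c * inn A B := by
  simp [inn]

lemma inn_add_right (A B C : M2) : inn A (B + C) = inn A B + inn A C := by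
  simp [inn, Matrix.mul_add]

lemma inn_smul_right (c : ℝ) (A B : M2) : inn A (c • B) = c * inn A B := by
  simp [inn]

lemma inn_one_left (A : M2) : inn 1 A = A.trace := by
  simp [inn]

lemma inn_zero_left (A : M2) : inn 0 A = 0 := by
  simp [inn]

lemma inn_self_nonneg (A : M2) : 0 ≤ inn A A := by
  rw [inn_eq_sum]
  linarith [mul_self_nonneg (A 0 0), mul_self_nonneg (A 0 1), mul_self_nonneg (A 1 0),
    mul_self_nonneg (A 1 1)]

lemma inn_sq_le (A B : M2) : inn A B ^ 2 ≤ inn A A * inn B B := by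
  simp only [inn_eq_sum]
  nlinarith [sq_nonneg (A 0 0 * B 0 1 - A 0 1 * B 0 0), sq_nonneg (A 0 0 * B 1 0 - A 1 0 * B 0 0),
    sq_nonneg (A 0 0 * B 1 1 - A 1 1 * B 0 0), sq_nonneg (A 0 1 * B 1 0 - A 1 0 * B 0 1),
    sq_nonneg (A 0 1 * B 1 1 - A 1 1 * B 0 1), sq_nonneg (A 1 0 * B 1 1 - A 1 1 * B 1 0)]

lemma inn_dev_left (A B : M2) : inn (dev A) B = inn (dev A) (dev B) := by
  simp only [inn_eq_sum, dev, Matrix.trace_fin_two, Matrix.sub_apply, Matrix.smul_apply,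
    Matrix.one_apply, smul_eq_mul]
  norm_num
  ring

lemma fnorm_nonneg (A : M2) : 0 ≤ fnorm A := Real.sqrt_nonneg _

lemma fnorm_sq (A : M2) : fnorm A ^ 2 = inn A A := Real.sq_sqrt (inn_self_nonneg A)

lemma betaC_nonneg {α lam mu : ℝ} (hmu : 0 < mu) (hlm : 0 < lam + mu) : 0 ≤ betaC α lam mu := by
  unfold betaC
  positivity

/-- The value of the form `𝒢(ξ, η₁) : η₂`, in a manifestly symmetric way. -/
lemma inn_calG (α lam mu : ℝ) (ξ η₁ η₂ : M2) :
    inn (calG α lam mu ξ η₁) η₂ =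
      if ξ ∈ A1 α lam mu then
        (lam + mu) * (η₁.trace * η₂.trace) + 2 * mu * inn (dev η₁) (dev η₂)
      else if ξ ∈ A2 α ∨ ξ = 0 then 0
      else
        2 * betaC α lam mu *
          ((inn (dev ξ) (dev η₁) / fnorm (dev ξ) - η₁.trace / (2 * α)) *
            (inn (dev ξ) (dev η₂) / fnorm (dev ξ) - η₂.trace / (2 * α))) +
        2 * betaC α lam mu * (fnorm (dev ξ) - ξ.trace / (2 * α)) * (fnorm (dev ξ))⁻¹ *
          (inn (dev η₁) (dev η₂) -
            inn (dev ξ) (dev η₁) * inn (dev ξ) (dev η₂) / fnorm (dev ξ) ^ 2) := by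
  unfold calG
  split_ifs
  · rw [inn_add_left, inn_smul_left, inn_smul_left, inn_one_left, inn_dev_left]
    ring
  · exact inn_zero_left _
  · simp only [inn_add_left, inn_sub_left, inn_smul_left, inn_one_left, inn_dev_left _ η₂]
    ring

lemma inn_calG_comm (α lam mu : ℝ) (ξ η₁ η₂ : M2) :
    inn (calG α lam mu ξ η₁) η₂ = inn (calG α lam mu ξ η₂) η₁ := by
  rw [inn_calG, inn_calG, inn_comm (dev η₁) (dev η₂)]
  split_ifs <;> ring

lemma inn_calG_self_nonneg {α lam mu : ℝ} (hmu : 0 < mu) (hlm : 0 < lam + mu)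
    {ξ : M2} (hξ : ξ.IsSymm) (η : M2) : 0 ≤ inn (calG α lam mu ξ η) η := by
  rw [inn_calG]
  split_ifs with h₁ h₂
  · have := inn_self_nonneg (dev η)
    have := mul_self_nonneg η.trace
    positivity
  · exact le_rfl
  · have hβ := betaC_nonneg (α := α) hmu hlm
    have hn := fnorm_nonneg (dev ξ)
    have hgap : 0 ≤ fnorm (dev ξ) - ξ.trace / (2 * α) := by
      by_contra! h
      exact h₂ (Or.inl ⟨hξ, by linarith⟩)
    have hcs : 0 ≤ inn (dev η) (dev η) -
        inn (dev ξ) (dev η) * inn (dev ξ) (dev η) / fnorm (dev ξ) ^ 2 := by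
      rw [sub_nonneg, fnorm_sq]
      refine div_le_of_le_mul₀ (inn_self_nonneg _) (inn_self_nonneg _) ?_
      linarith [inn_sq_le (dev ξ) (dev η)]
    exact add_nonneg (mul_nonneg (by positivity) (mul_self_nonneg _))
      (mul_nonneg (mul_nonneg (mul_nonneg (by positivity) hgap) (by positivity)) hcs)

lemma inn_calG_add_smul_self (α lam mu : ℝ) (ξ η₁ η₂ : M2) (s : ℝ) :
    inn (calG α lam mu ξ (η₁ + s • η₂)) (η₁ + s • η₂) =
      inn (calG α lam mu ξ η₂) η₂ * (s * s) + 2 * inn (calG α lam mu ξ η₁) η₂ * s +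
        inn (calG α lam mu ξ η₁) η₁ := by
  have h (η : M2) : inn (calG α lam mu ξ (η₁ + s • η₂)) η =
      inn (calG α lam mu ξ η₁) η + s * inn (calG α lam mu ξ η₂) η := by
    rw [inn_calG_comm, inn_add_right, inn_smul_right, inn_calG_comm _ _ _ _ η,
      inn_calG_comm _ _ _ _ η]
  rw [h, inn_add_right, inn_add_right, inn_smul_right, inn_smul_right,
    inn_calG_comm _ _ _ _ η₂ η₁]
  ring

/-- For every symmetric `ξ`, `(η₁,η₂) ↦ 𝒢(ξ,η₁) : η₂` is a symmetric,
positive semidefinite bilinear form, and the Cauchy–Schwarz inequality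
`𝒢(ξ,η₁) : η₂ ≤ √(𝒢(ξ,η₁):η₁) √(𝒢(ξ,η₂):η₂)` holds. -/
theorem stmt_14 (α lam mu : ℝ) (hα : 0 < α) (hmu : 0 < mu) (hlm : 0 < lam + mu)
    (ξ : M2) (hξ : ξ.IsSymm) :
    (∀ η₁ η₂ : M2, η₁.IsSymm → η₂.IsSymm →
      inn (calG α lam mu ξ η₁) η₂ = inn (calG α lam mu ξ η₂) η₁) ∧
    (∀ η : M2, η.IsSymm → 0 ≤ inn (calG α lam mu ξ η) η) ∧
    (∀ η₁ η₂ : M2, η₁.IsSymm → η₂.IsSymm →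
      inn (calG α lam mu ξ η₁) η₂ ≤
        Real.sqrt (inn (calG α lam mu ξ η₁) η₁) *
          Real.sqrt (inn (calG α lam mu ξ η₂) η₂)) := by
  have hpos := inn_calG_self_nonneg (α := α) hmu hlm hξ
  refine ⟨fun η₁ η₂ _ _ => inn_calG_comm α lam mu ξ η₁ η₂, fun η _ => hpos η,
    fun η₁ η₂ _ _ => ?_⟩
  have hdiscr := discrim_le_zero fun s : ℝ =>
    (hpos (η₁ + s • η₂)).trans_eq (inn_calG_add_smul_self α lam mu ξ η₁ η₂ s)
  rw [discrim] at hdiscr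
  rw [← Real.sqrt_mul (hpos η₁)]
  exact Real.le_sqrt_of_sq_le (by linarith)
end
end
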